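/- Fix a user κ ∈ {1,…,N} with N ≥ 2. Under the product measure on Ω = (Fin N → Fin m) with i.i.d. coordinates of law ρ, the probability of the Three-Node Full-Duplex (TNFD) event {r ∈ Ω : ∃ ν ∈ {1,…,N}\{κ} with r(κ) = ν, r(ν) ≠ κ, and ∃ τ ∉ {κ, ν}, r(τ) = κ} equals (P_hit − ρ_κ)(1 − ρ_κ − (1 − ρ_κ)^{N−1}), where P_hit = Σ_{ℓ=1}^N ρ_ℓ. Consequently, the probability that a uniformly chosen user operates in TNFD mode equals (1/N) Σ_{κ=1}^N (P_hit − ρ_κ)(1 − ρ_κ − (1 − ρ_κ)^{N−1}). -/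

import Mathlib

open Finset

open scoped Classical

/-- Zipf popularity: content `κ` (0-indexed, representing content `κ+1`) has
popularity `(κ+1)^{-γ} / ∑_{η=1}^m η^{-γ}`. -/
noncomputable def zipf (m : ℕ) (γ : ℝ) (κ : Fin m) : ℝ :=
  (((κ : ℕ) : ℝ) + 1) ^ (-γ) / ∑ η : Fin m, (((η : ℕ) : ℝ) + 1) ^ (-γ)

/-- Probability of the event `E` on `Ω = (Fin N → Fin m)` under the product measure in
which each coordinate is i.i.d. with probability mass function `ρ`. -/
noncomputable def prob {N m : ℕ} (ρ : Fin m → ℝ) (E : (Fin N → Fin m) → Prop) : ℝ :=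
  ∑ r : Fin N → Fin m, if E r then ∏ τ : Fin N, ρ (r τ) else 0

theorem sum_zipf {m : ℕ} (hm : 0 < m) (γ : ℝ) : ∑ η : Fin m, zipf m γ η = 1 := by
  have : Nonempty (Fin m) := ⟨⟨0, hm⟩⟩
  unfold zipf
  rw [← Finset.sum_div]
  refine div_self (ne_of_gt (Finset.sum_pos (fun η _ => ?_) Finset.univ_nonempty))
  positivity

/-- Coordinatewise constraints are independent under the product weights. -/
theorem prob_forall {N m : ℕ} (ρ : Fin m → ℝ) (P : Fin N → Fin m → Prop) :
    prob ρ (fun r => ∀ τ, P τ (r τ)) = ∏ τ, ∑ x, if P τ x then ρ x else 0 := by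
  rw [Finset.prod_univ_sum, Fintype.piFinset_univ]
  refine Finset.sum_congr rfl fun r _ => ?_
  split_ifs with h
  · exact Finset.prod_congr rfl fun τ _ => (if_pos (h τ)).symm
  · push Not at h
    obtain ⟨τ, hτ⟩ := h
    exact (Finset.prod_eq_zero (Finset.mem_univ τ) (if_neg hτ)).symm

/-- The probability that user `κ` requests `a` while no user of `S` requests `b`. -/
theorem prob_eq_and_forall_ne {N m : ℕ} (ρ : Fin m → ℝ) (hρ : ∑ x, ρ x = 1) (κ : Fin N)
    (S : Finset (Fin N)) (hS : κ ∉ S) (a b : Fin m) :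
    prob ρ (fun r => r κ = a ∧ ∀ τ ∈ S, r τ ≠ b) = ρ a * (1 - ρ b) ^ #S := by
  have hE : (fun r : Fin N → Fin m => r κ = a ∧ ∀ τ ∈ S, r τ ≠ b) =
      fun r => ∀ τ, (τ = κ → r τ = a) ∧ (τ ∈ S → r τ ≠ b) := by
    ext r
    simp only [forall_and, forall_eq]
  have hne : (∑ x, if x ≠ b then ρ x else 0) = 1 - ρ b := by
    rw [← Finset.sum_filter, Finset.filter_ne', ← hρ,
      ← Finset.add_sum_erase _ _ (Finset.mem_univ b), add_sub_cancel_left]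
  rw [hE, prob_forall ρ fun τ x => (τ = κ → x = a) ∧ (τ ∈ S → x ≠ b),
    ← Finset.mul_prod_erase _ _ (Finset.mem_univ κ)]
  congr 1
  · simp [hS]
  · have hsub : S ⊆ Finset.univ.erase κ := fun τ hτ =>
      Finset.mem_erase.2 ⟨fun h => hS (h ▸ hτ), Finset.mem_univ τ⟩
    rw [← Finset.prod_const, ← Finset.prod_subset hsub]
    · refine Finset.prod_congr rfl fun τ hτ => ?_
      rw [← hne]
      have : τ ≠ κ := fun h => hS (h ▸ hτ)
      simp [this, hτ]
    · intro τ hτ hτS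
      simp [Finset.ne_of_mem_erase hτ, hτS, hρ]

/-- The probability of TNFD mode at a user `κ`, for any weights of total mass `1` and any
injective assignment `c` of cached contents to users. -/
theorem prob_exists_three_node {N m : ℕ} (ρ : Fin m → ℝ) (hρ : ∑ x, ρ x = 1)
    (c : Fin N → Fin m) (hc : Function.Injective c) (κ : Fin N) :
    prob ρ (fun r => ∃ ν : Fin N, ν ≠ κ ∧ r κ = c ν ∧ r ν ≠ c κ ∧
        ∃ τ : Fin N, τ ≠ κ ∧ τ ≠ ν ∧ r τ = c κ)
      = ((∑ ℓ : Fin N, ρ (c ℓ)) - ρ (c κ)) *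
          (1 - ρ (c κ) - (1 - ρ (c κ)) ^ (N - 1)) := by
  have hsplit : prob ρ (fun r => ∃ ν : Fin N, ν ≠ κ ∧ r κ = c ν ∧ r ν ≠ c κ ∧
        ∃ τ : Fin N, τ ≠ κ ∧ τ ≠ ν ∧ r τ = c κ) =
      ∑ ν ∈ Finset.univ.erase κ,
        (prob ρ (fun r => r κ = c ν ∧ ∀ τ ∈ ({ν} : Finset (Fin N)), r τ ≠ c κ) -
          prob ρ (fun r => r κ = c ν ∧ ∀ τ ∈ Finset.univ.erase κ, r τ ≠ c κ)) := by
    unfold prob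
    simp_rw [← Finset.sum_sub_distrib]
    rw [Finset.sum_comm]
    refine Finset.sum_congr rfl fun r _ => ?_
    by_cases h : ∃ ν ∈ Finset.univ.erase κ, r κ = c ν
    · obtain ⟨ν, hν, hr⟩ := h
      have hνκ := Finset.ne_of_mem_erase hν
      rw [Finset.sum_eq_single_of_mem ν hν]
      · have hiff : (∃ ν : Fin N, ν ≠ κ ∧ r κ = c ν ∧ r ν ≠ c κ ∧
            ∃ τ : Fin N, τ ≠ κ ∧ τ ≠ ν ∧ r τ = c κ) ↔
            r ν ≠ c κ ∧ ¬ ∀ τ ∈ Finset.univ.erase κ, r τ ≠ c κ := by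
          constructor
          · rintro ⟨μ, -, hμ, hne, τ, hτ, -, hrτ⟩
            obtain rfl : μ = ν := hc (hμ.symm.trans hr)
            exact ⟨hne, fun H => H τ (by simp [hτ]) hrτ⟩
          · rintro ⟨hne, H⟩
            push Not at H
            obtain ⟨τ, hτ, hrτ⟩ := H
            exact ⟨ν, hνκ, hr, hne, τ, Finset.ne_of_mem_erase hτ,
              fun h => hne (h ▸ hrτ), hrτ⟩
        have himp : (∀ τ ∈ Finset.univ.erase κ, r τ ≠ c κ) → r ν ≠ c κ := fun H => H ν hν
        simp only [hiff]
        simp only [hr, true_and, Finset.mem_singleton, forall_eq]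
        by_cases h₁ : r ν ≠ c κ <;>
          by_cases h₂ : ∀ τ ∈ Finset.univ.erase κ, r τ ≠ c κ
        · rw [if_neg (fun h => h.2 h₂), if_pos h₁, if_pos h₂, sub_self]
        · rw [if_pos ⟨h₁, h₂⟩, if_pos h₁, if_neg h₂, sub_zero]
        · exact absurd (himp h₂) h₁
        · rw [if_neg (fun h => h₁ h.1), if_neg h₁, if_neg h₂, sub_zero]
      · intro μ _ hμ
        have : r κ ≠ c μ := fun h => hμ (hc (h.symm.trans hr))
        rw [if_neg (fun h => this h.1), if_neg (fun h => this h.1), sub_zero]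
    · rw [if_neg, Finset.sum_eq_zero]
      · intro ν hν
        have : r κ ≠ c ν := fun hr => h ⟨ν, hν, hr⟩
        rw [if_neg (fun h => this h.1), if_neg (fun h => this h.1), sub_zero]
      · rintro ⟨ν, hν, hr, -⟩
        exact h ⟨ν, by simp [hν], hr⟩
  rw [hsplit, ← Finset.add_sum_erase _ _ (Finset.mem_univ κ), add_sub_cancel_left,
    Finset.sum_mul]
  refine Finset.sum_congr rfl fun ν hν => ?_
  rw [prob_eq_and_forall_ne ρ hρ κ {ν}
      (by simpa using (Finset.ne_of_mem_erase hν).symm),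
    prob_eq_and_forall_ne ρ hρ κ _ (Finset.notMem_erase κ _),
    Finset.card_singleton, Finset.card_erase_of_mem (Finset.mem_univ κ), Finset.card_univ,
    Fintype.card_fin]
  ring

/-- TNFD mode: user `κ` requests the content cached by some other user `ν`, user `ν`
does not request content `κ`, but some third user requests content `κ`. Its probability
is `(P_hit - ρ_κ)(1 - ρ_κ - (1-ρ_κ)^(N-1))`, and the probability that a uniformly
chosen user operates in TNFD mode is the average. -/
theorem prob_TNFD (m N : ℕ) (γr : ℝ) (hγr : 0 < γr)
    (hN : 2 ≤ N) (hNm : N ≤ m) (ρ : Fin m → ℝ) (hρ : ρ = zipf m γr) (κ : Fin N) :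
    prob ρ (fun r => ∃ ν : Fin N, ν ≠ κ ∧ r κ = Fin.castLE hNm ν ∧
        r ν ≠ Fin.castLE hNm κ ∧
        ∃ τ : Fin N, τ ≠ κ ∧ τ ≠ ν ∧ r τ = Fin.castLE hNm κ)
      = ((∑ ℓ : Fin N, ρ (Fin.castLE hNm ℓ)) - ρ (Fin.castLE hNm κ)) *
          (1 - ρ (Fin.castLE hNm κ) - (1 - ρ (Fin.castLE hNm κ)) ^ (N - 1))
    ∧ (1 / (N : ℝ)) * ∑ κ' : Fin N,
        prob ρ (fun r => ∃ ν : Fin N, ν ≠ κ' ∧ r κ' = Fin.castLE hNm ν ∧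
          r ν ≠ Fin.castLE hNm κ' ∧
          ∃ τ : Fin N, τ ≠ κ' ∧ τ ≠ ν ∧ r τ = Fin.castLE hNm κ')
      = (1 / (N : ℝ)) * ∑ κ' : Fin N,
          ((∑ ℓ : Fin N, ρ (Fin.castLE hNm ℓ)) - ρ (Fin.castLE hNm κ')) *
            (1 - ρ (Fin.castLE hNm κ') - (1 - ρ (Fin.castLE hNm κ')) ^ (N - 1)) := by
  have hsum : ∑ x, ρ x = 1 := hρ ▸ sum_zipf (by omega) γr
  have key := prob_exists_three_node ρ hsum (Fin.castLE hNm) (Fin.castLE_injective hNm)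
  exact ⟨key κ, congrArg _ (Finset.sum_congr rfl fun κ' _ => key κ')⟩
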